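/- arXiv:1103.5740 — 2 statements merged into one kernel-verified Lean document; each statement's English description precedes it below -/
import Mathlib

section
/- Existence of a shared-twiddle-factor butterfly matching one side's twiddles (Theorem 3.2, cases B and C): Let n be a positive integer and ω_n = exp(−2πi/n). Let t₀, t₁, p₀, p₁, q₀, q₁ be integers such that p₁ − p₀ ≡ q₁ − q₀ (mod n). Then there exists an integer v such that for all complex numbers a₀, a₁: ω_n^{t₁}·(a₀·ω_n^{q₀} + a₁·ω_n^{q₁}) = ω_n^{v}·(a₀·ω_n^{p₀} + a₁·ω_n^{p₁}); and symmetrically, there exists an integer u such that for all a₀, a₁: ω_n^{t₀}·(a₀·ω_n^{p₀} + a₁·ω_n^{p₁}) = ω_n^{u}·(a₀·ω_n^{q₀} + a₁·ω_n^{q₁}). That is, both outputs of the butterfly can be realized using the same pair of input twiddle factors, taken from either output's original pair. (Powers of ω_n with integer exponents are taken as zpow.) -/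
theorem zpow_eq_zpow_of_modEq {G : Type*} [GroupWithZero G] {x : G} (hx : x ≠ 0) {n : ℕ}
    (hxn : x ^ n = 1) {a b : ℤ} (h : a ≡ b [ZMOD (n : ℤ)]) : x ^ a = x ^ b := by
  obtain ⟨k, hk⟩ := h.dvd
  rw [eq_add_of_sub_eq' hk, zpow_add₀ hx, zpow_mul, zpow_natCast, hxn, one_zpow, mul_one]

theorem exists_zpow_mul_butterfly_eq {K : Type*} [Field K] {x : K} (hx : x ≠ 0) {n : ℕ}
    (hxn : x ^ n = 1) (t p₀ p₁ q₀ q₁ : ℤ) (h : p₁ - p₀ ≡ q₁ - q₀ [ZMOD (n : ℤ)]) :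
    ∃ v : ℤ, ∀ a₀ a₁ : K,
      x ^ t * (a₀ * x ^ q₀ + a₁ * x ^ q₁) = x ^ v * (a₀ * x ^ p₀ + a₁ * x ^ p₁) := by
  refine ⟨t + q₀ - p₀, fun a₀ a₁ => ?_⟩
  have h₀ : x ^ (t + q₀ - p₀) * x ^ p₀ = x ^ t * x ^ q₀ := by
    rw [← zpow_add₀ hx, ← zpow_add₀ hx, sub_add_cancel]
  have h₁ : x ^ (t + q₀ - p₀) * x ^ p₁ = x ^ t * x ^ q₁ := by
    rw [← zpow_add₀ hx, ← zpow_add₀ hx]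
    apply zpow_eq_zpow_of_modEq hx hxn
    convert h.add_left (t + q₀) using 1 <;> ring
  linear_combination -a₀ * h₀ - a₁ * h₁

/-- Existence of a shared-twiddle-factor butterfly matching one side's twiddles
(Theorem 3.2, cases B and C). -/
theorem shared_twiddle_match (n : ℕ) (hn : 0 < n)
    (ω : ℂ) (hω : ω = Complex.exp (-2 * Real.pi * Complex.I / n))
    (t₀ t₁ p₀ p₁ q₀ q₁ : ℤ)
    (hstride : p₁ - p₀ ≡ q₁ - q₀ [ZMOD (n : ℤ)]) :
    (∃ v : ℤ, ∀ a₀ a₁ : ℂ,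
      ω ^ t₁ * (a₀ * ω ^ q₀ + a₁ * ω ^ q₁) = ω ^ v * (a₀ * ω ^ p₀ + a₁ * ω ^ p₁)) ∧
    (∃ u : ℤ, ∀ a₀ a₁ : ℂ,
      ω ^ t₀ * (a₀ * ω ^ p₀ + a₁ * ω ^ p₁) = ω ^ u * (a₀ * ω ^ q₀ + a₁ * ω ^ q₁)) := by
  have hω₀ : ω ≠ 0 := hω ▸ Complex.exp_ne_zero _
  have hωn : ω ^ n = 1 := by
    have hn₀ : (n : ℂ) ≠ 0 := Nat.cast_ne_zero.mpr hn.ne'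
    rw [hω, ← Complex.exp_nat_mul, mul_div_cancel₀ _ hn₀, neg_mul, neg_mul, Complex.exp_neg,
      Complex.exp_two_pi_mul_I, inv_one]
  exact ⟨exists_zpow_mul_butterfly_eq hω₀ hωn t₁ p₀ p₁ q₀ q₁ hstride,
    exists_zpow_mul_butterfly_eq hω₀ hωn t₀ q₀ q₁ p₀ p₁ hstride.symm⟩
end

section
/- Twisting lemma: Let m ≥ 1 be a natural number, let c ∈ ℂ, and let w ∈ ℂ be nonzero. Then for every polynomial f ∈ ℂ[X], (f.comp (C w · X)) %ₘ (X^m − C (c / w^m)) = (f %ₘ (X^m − C c)).comp (C w · X). In words: if r is the residue of f modulo X^m − c, then r(w·x) is the residue of f(w·x) modulo X^m − c·w^{−m}. In particular, taking w with w^m = −1 twists a residue modulo X^m + 1 into a residue modulo X^m − 1. -/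
open Polynomial

/-- Twisting lemma: the residue of `f(w·x)` modulo `X^m − c/w^m` is the twist of
the residue of `f` modulo `X^m − c`. -/
theorem twisting_lemma (m : ℕ) (hm : 1 ≤ m) (c : ℂ) (w : ℂ) (hw : w ≠ 0)
    (f : ℂ[X]) :
    (f.comp (C w * X)) %ₘ (X ^ m - C (c / w ^ m)) =
      (f %ₘ (X ^ m - C c)).comp (C w * X) := by
  have hm0 : m ≠ 0 := Nat.one_le_iff_ne_zero.mp hm
  have hmod : (X ^ m - C c).comp (C w * X) = (X ^ m - C (c / w ^ m)) * C (w ^ m) := by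
    rw [sub_comp, X_pow_comp, C_comp, sub_mul, ← C_mul, div_mul_cancel₀ _ (pow_ne_zero m hw),
      mul_pow, C_pow, mul_comm]
  refine (div_modByMonic_unique (C (w ^ m) * (f /ₘ (X ^ m - C c)).comp (C w * X)) _
    (monic_X_pow_sub_C _ hm0) ⟨?_, ?_⟩).2
  · rw [← mul_assoc, ← hmod, ← mul_comp, ← add_comp, modByMonic_add_div]
  · have hlt := degree_modByMonic_lt f (monic_X_pow_sub_C c hm0)
    have hdeg : (C w * X).degree = 1 := degree_C_mul_X hw
    rw [degree_X_pow_sub_C hm] at hlt ⊢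
    rw [degree_comp (by rw [hdeg]; exact zero_lt_one), hdeg]
    simpa using hlt
end
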